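/- (Octahedral Tucker lemma.) Let n ≥ 2 and let λ be a function from the nonzero sign vectors {+,−,0}^n \ {0} to the set {±1, ±2, …, ±(n−1)} of nonzero integers of absolute value at most n−1, satisfying λ(−x) = −λ(x) for every nonzero sign vector x. Then there exist nonzero sign vectors x and y with x ⪯ y and λ(x) = −λ(y). -/

import Mathlib

namespace OctahedralTucker

open Finset

/-- The sign change on labels, where the signed integers `a` and `-a` with `a > 0` are encoded as
the natural numbers `2 * a + 1` and `2 * a`. -/
def flipSign (a : ℕ) : ℕ := if a % 2 = 0 then a + 1 else a - 1

theorem flipSign_flipSign (a : ℕ) : flipSign (flipSign a) = a := by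
  unfold flipSign; split_ifs <;> omega

theorem flipSign_le_flipSign {a b : ℕ} (hab : a ≤ b) (h : a ≠ flipSign b) :
    flipSign a ≤ flipSign b := by
  unfold flipSign at *; split_ifs at * <;> omega

/-- The indicator that the parities of the entries of a list alternate, the first entry being odd
if and only if `b` is `true`. -/
def altInd : Bool → List ℕ → ZMod 2
  | _, [] => 1
  | b, a :: l => if decide (a % 2 = 1) = b then altInd (!b) l else 0

theorem altInd_map_flipSign (b : Bool) (l : List ℕ) :
    altInd b (l.map flipSign) = altInd (!b) l := by
  induction l generalizing b with
  | nil => rfl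
  | cons a l ih =>
    have h : decide (flipSign a % 2 = 1) = !decide (a % 2 = 1) := by
      rw [← decide_not, decide_eq_decide]; unfold flipSign; split_ifs <;> omega
    simp only [List.map_cons, altInd, ih, h]
    cases b <;> cases decide (a % 2 = 1) <;> rfl

theorem sum_altInd_erase (b : Bool) (l : List ℕ) (hl : l.Pairwise (· ≤ ·)) :
    (l.map fun a => altInd b (l.erase a)).sum = altInd b l + altInd (!b) l := by
  induction l generalizing b with
  | nil => decide +revert
  | cons x l ih =>
    have hl' := List.pairwise_cons.1 hl
    have herase : ∀ a ∈ l, altInd b ((x :: l).erase a) =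
        if decide (x % 2 = 1) = b then altInd (!b) (l.erase a) else 0 := by
      intro a ha
      have : (x :: l).erase a = x :: l.erase a := by
        refine List.Perm.eq_of_pairwise' (r := (· ≤ ·)) (hl.sublist List.erase_sublist)
          (hl.sublist (List.erase_sublist.cons_cons x)) ?_
        rw [List.erase_cons]
        split_ifs with h
        · obtain rfl : x = a := by simpa using h
          exact List.perm_cons_erase ha
        · rfl
      rw [this, altInd]
    rw [List.map_cons, List.sum_cons, List.map_congr_left herase, List.erase_cons_head]
    by_cases h : decide (x % 2 = 1) = b
    · simp only [h, if_true, ih (!b) hl'.2, altInd, Bool.not_not]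
      have : b ≠ !b := by cases b <;> decide
      rw [if_neg this, add_left_comm, CharTwo.add_self_eq_zero]
    · have h' : decide (x % 2 = 1) = !b := by
        revert h; cases b <;> cases decide (x % 2 = 1) <;> simp
      simp [altInd, h']

theorem pairwise_half_lt_of_altInd_ne_zero {b : Bool} {l : List ℕ} (hl : l.Pairwise (· ≤ ·))
    (hflip : ∀ a ∈ l, ∀ c ∈ l, a ≠ flipSign c) (h : altInd b l ≠ 0) :
    (l.map (· / 2)).Pairwise (· < ·) := by
  rw [← List.isChain_iff_pairwise]
  induction l generalizing b with
  | nil => simp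
  | cons x l ih =>
    have hl' := List.pairwise_cons.1 hl
    simp only [altInd, ne_eq, ite_eq_right_iff, Classical.not_imp] at h
    have hc := ih hl'.2 (fun a ha c hc => hflip a (by simp [ha]) c (by simp [hc])) h.2
    cases l with
    | nil => simp
    | cons y l =>
      refine List.isChain_cons_cons.2 ⟨?_, hc⟩
      obtain ⟨h₁, h₂⟩ := h
      simp only [altInd, ite_eq_right_iff, Classical.not_imp] at h₂
      have h₃ := h₂.1
      have h₄ := hl'.1 y (by simp)
      have h₅ := hflip x (by simp) y (by simp)
      rw [← h₁, ← decide_not, decide_eq_decide] at h₃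
      unfold flipSign at h₅
      change x / 2 < y / 2
      split_ifs at h₅ <;> omega

/-- The alternation indicator of the increasing enumeration of a multiset. -/
def multisetAltInd (b : Bool) (M : Multiset ℕ) : ZMod 2 := altInd b (M.sort (· ≤ ·))

theorem multisetAltInd_map_flipSign (b : Bool) (M : Multiset ℕ)
    (h : ∀ a ∈ M, ∀ c ∈ M, a ≠ flipSign c) :
    multisetAltInd b (M.map flipSign) = multisetAltInd (!b) M := by
  rw [multisetAltInd, ← Multiset.map_sort flipSign M (· ≤ ·) (· ≤ ·), altInd_map_flipSign,
    multisetAltInd]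
  intro a ha c hc
  refine ⟨fun hac => flipSign_le_flipSign hac (h a ha c hc), fun hac => ?_⟩
  simpa only [flipSign_flipSign] using
    flipSign_le_flipSign hac fun h' => h c hc a ha (by rw [h', flipSign_flipSign])

theorem sum_multisetAltInd_erase (b : Bool) (M : Multiset ℕ) :
    (M.map fun a => multisetAltInd b (M.erase a)).sum =
      multisetAltInd b M + multisetAltInd (!b) M := by
  have hM := Multiset.pairwise_sort M (· ≤ ·)
  rw [multisetAltInd, multisetAltInd, ← sum_altInd_erase b _ hM]
  conv_lhs => rw [← Multiset.sort_eq M (· ≤ ·)]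
  rw [Multiset.map_coe, Multiset.sum_coe]
  congr 1
  refine List.map_congr_left fun a _ => ?_
  rw [multisetAltInd, Multiset.coe_erase]
  congr 1
  refine List.Perm.eq_of_pairwise' (r := (· ≤ ·)) (Multiset.pairwise_sort _ _)
    (hM.sublist List.erase_sublist) ?_
  rw [← Multiset.coe_eq_coe, Multiset.sort_eq]

/-- The `i`-th sign vector of the complete flag that switches on the coordinate `j` at step `ρ j`
with the sign given by `s j`. -/
def flagVertex {n : ℕ} (ρ : Equiv.Perm (Fin n)) (s : Fin n → Bool) (i : Fin n) :
    Fin n → SignType :=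
  fun j => if ρ j ≤ i then (if s j then 1 else -1) else 0

/-- The labels of the vertices of a flag with indices in `A`. -/
def flagLabels {n : ℕ} (κ : (Fin n → SignType) → ℕ) (ρ : Equiv.Perm (Fin n)) (s : Fin n → Bool)
    (A : Finset (Fin n)) : Multiset ℕ :=
  A.val.map fun i => κ (flagVertex ρ s i)

section Flag

variable {n : ℕ} (κ : (Fin n → SignType) → ℕ) (ρ : Equiv.Perm (Fin n)) (s : Fin n → Bool)

theorem flagVertex_ne_zero (i : Fin n) : flagVertex ρ s i ≠ 0 := by
  intro h
  have := congrFun h (ρ.symm i)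
  simp only [flagVertex, Equiv.apply_symm_apply, le_refl, if_true, Pi.zero_apply] at this
  split_ifs at this

theorem flagVertex_not (i : Fin n) : flagVertex ρ (fun j => !s j) i = -flagVertex ρ s i := by
  funext j
  simp only [flagVertex, Pi.neg_apply]
  split_ifs <;> simp_all

theorem flagVertex_le {i k : Fin n} (h : i ≤ k) (j : Fin n) :
    flagVertex ρ s i j = 0 ∨ flagVertex ρ s i j = flagVertex ρ s k j := by
  by_cases hj : ρ j ≤ i
  · right; simp [flagVertex, hj, hj.trans h]
  · left; simp [flagVertex, hj]

variable {κ}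

theorem flagLabels_ne_flipSign
    (hκ : ∀ x y : Fin n → SignType, x ≠ 0 → y ≠ 0 → (∀ i, x i = 0 ∨ x i = y i) →
      κ x ≠ flipSign (κ y)) :
    ∀ a ∈ flagLabels κ ρ s univ, ∀ c ∈ flagLabels κ ρ s univ, a ≠ flipSign c := by
  simp only [flagLabels, Multiset.mem_map, mem_val, mem_univ, true_and, forall_exists_index,
    forall_apply_eq_imp_iff]
  intro i k
  rcases le_total i k with h | h
  · exact hκ _ _ (flagVertex_ne_zero _ _ _) (flagVertex_ne_zero _ _ _) (flagVertex_le ρ s h)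
  · intro h'
    refine hκ _ _ (flagVertex_ne_zero ρ s k) (flagVertex_ne_zero ρ s i) (flagVertex_le ρ s h) ?_
    rw [h', flipSign_flipSign]

theorem multisetAltInd_flagLabels_not (b : Bool)
    (hanti : ∀ x : Fin n → SignType, x ≠ 0 → κ (-x) = flipSign (κ x))
    (hκ : ∀ x y : Fin n → SignType, x ≠ 0 → y ≠ 0 → (∀ i, x i = 0 ∨ x i = y i) →
      κ x ≠ flipSign (κ y)) :
    multisetAltInd b (flagLabels κ ρ (fun j => !s j) univ) =
      multisetAltInd (!b) (flagLabels κ ρ s univ) := by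
  rw [← multisetAltInd_map_flipSign _ _ (flagLabels_ne_flipSign ρ s hκ)]
  simp only [flagLabels, Multiset.map_map, Function.comp_def, flagVertex_not,
    hanti _ (flagVertex_ne_zero _ _ _)]

theorem sum_multisetAltInd_flagLabels_erase (b : Bool) :
    ∑ i, multisetAltInd b (flagLabels κ ρ s (univ.erase i)) =
      multisetAltInd b (flagLabels κ ρ s univ) + multisetAltInd (!b) (flagLabels κ ρ s univ) := by
  rw [← sum_multisetAltInd_erase]
  conv_rhs => rw [flagLabels, Multiset.map_map]
  refine sum_congr rfl fun i _ => ?_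
  simp only [Function.comp_apply]
  rw [flagLabels, erase_val, Multiset.map_erase_of_mem _ _ (mem_univ i)]

theorem flagLabels_congr {ρ' : Equiv.Perm (Fin n)} {s' : Fin n → Bool} {A : Finset (Fin n)}
    (h : ∀ i ∈ A, flagVertex ρ s i = flagVertex ρ' s' i) :
    flagLabels κ ρ s A = flagLabels κ ρ' s' A :=
  Multiset.map_congr rfl fun i hi => by rw [h i hi]

end Flag

section Step

variable {n : ℕ} (κ : (Fin (n + 1) → SignType) → ℕ)

theorem sum_flags_erase_castSucc (b : Bool) (k : Fin n) :
    ∑ p : Equiv.Perm (Fin (n + 1)) × (Fin n → Bool), multisetAltInd b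
      (flagLabels κ p.1 (Fin.snoc p.2 true) (univ.erase k.castSucc)) = 0 := by
  refine sum_involution (fun p _ => (p.1.trans (Equiv.swap k.castSucc k.succ), p.2)) ?_ ?_ ?_ ?_
  · rintro ⟨ρ, s⟩ -
    rw [flagLabels_congr (ρ' := ρ.trans (Equiv.swap k.castSucc k.succ))
      (s' := Fin.snoc s true), CharTwo.add_self_eq_zero]
    intro i hi
    have hi' : (i : ℕ) ≠ k := fun h => (mem_erase.1 hi).1 (Fin.ext h)
    funext j
    have : ρ j ≤ i ↔ Equiv.swap k.castSucc k.succ (ρ j) ≤ i := by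
      rw [Equiv.swap_apply_def]
      split_ifs with h₁ h₂
      · rw [h₁, Fin.le_def, Fin.le_def, Fin.val_castSucc, Fin.val_succ]; omega
      · rw [h₂, Fin.le_def, Fin.le_def, Fin.val_castSucc, Fin.val_succ]; omega
      · rfl
    simp only [flagVertex, Equiv.trans_apply]
    exact if_congr this rfl rfl
  · rintro ⟨ρ, s⟩ - - h
    have := Equiv.congr_fun (congrArg Prod.fst h) (ρ.symm k.castSucc)
    simp [Fin.ext_iff] at this
  · exact fun _ _ => mem_univ _
  · rintro ⟨ρ, s⟩ -
    refine Prod.ext (Equiv.ext fun j => ?_) rfl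
    simp

theorem sum_flags_erase_last_of_ne (b : Bool) :
    ∑ p : Equiv.Perm (Fin (n + 1)) × (Fin n → Bool) with p.1 (Fin.last n) ≠ Fin.last n,
      multisetAltInd b
        (flagLabels κ p.1 (Fin.snoc p.2 true) (univ.erase (Fin.last n))) = 0 := by
  refine sum_involution (fun p _ =>
    (p.1, fun k => if p.1 k.castSucc = Fin.last n then !p.2 k else p.2 k)) ?_ ?_ ?_ ?_
  · rintro ⟨ρ, s⟩ -
    dsimp only
    rw [flagLabels_congr (ρ' := ρ) (s := Fin.snoc s true)
      (s' := Fin.snoc (fun k => if ρ k.castSucc = Fin.last n then !s k else s k) true),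
      CharTwo.add_self_eq_zero]
    intro i hi
    have hi' : i < Fin.last n := lt_of_le_of_ne (Fin.le_last i) (mem_erase.1 hi).1
    funext j
    by_cases hj : ρ j ≤ i
    · have hj' : ρ j ≠ Fin.last n := (hj.trans_lt hi').ne
      induction j using Fin.lastCases with
      | last => simp [flagVertex]
      | cast j => simp [flagVertex, hj']
    · simp [flagVertex, hj]
  · rintro ⟨ρ, s⟩ hp - h
    have hne : ρ.symm (Fin.last n) ≠ Fin.last n := by
      rw [ne_eq, Equiv.symm_apply_eq]
      exact fun h' => (mem_filter.1 hp).2 h'.symm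
    obtain ⟨k, hk⟩ := Fin.exists_castSucc_eq.2 hne
    have := congrFun (congrArg Prod.snd h) k
    simp [hk] at this
  · intro p hp
    simpa using hp
  · rintro ⟨ρ, s⟩ -
    refine Prod.ext rfl (funext fun k => ?_)
    by_cases h : ρ k.castSucc = Fin.last n <;> simp [h]

/-- The extension of a permutation of `Fin n` to `Fin (n + 1)` fixing the last element. -/
def permSnoc (τ : Equiv.Perm (Fin n)) : Equiv.Perm (Fin (n + 1)) :=
  finSuccEquivLast.trans ((Equiv.optionCongr τ).trans finSuccEquivLast.symm)

@[simp] theorem permSnoc_last (τ : Equiv.Perm (Fin n)) :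
    permSnoc τ (Fin.last n) = Fin.last n := by
  simp [permSnoc]

@[simp] theorem permSnoc_castSucc (τ : Equiv.Perm (Fin n)) (i : Fin n) :
    permSnoc τ i.castSucc = (τ i).castSucc := by
  simp [permSnoc]

theorem permSnoc_injective : Function.Injective (permSnoc (n := n)) := by
  intro τ τ' h
  ext i
  simpa [Fin.ext_iff] using Equiv.congr_fun h i.castSucc

theorem exists_permSnoc_eq {ρ : Equiv.Perm (Fin (n + 1))} (h : ρ (Fin.last n) = Fin.last n) :
    ∃ τ, permSnoc τ = ρ := by
  have hρ : ∀ i : Fin n, ∃ j : Fin n, j.castSucc = ρ i.castSucc := fun i =>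
    Fin.exists_castSucc_eq.2 fun h' => i.castSucc_ne_last (ρ.injective (h'.trans h.symm))
  choose f hf using hρ
  have hinj : Function.Injective f := fun i j hij =>
    Fin.castSucc_injective n (ρ.injective (by rw [← hf, ← hf, hij]))
  refine ⟨Equiv.ofBijective f (Finite.injective_iff_bijective.1 hinj), Equiv.ext fun i => ?_⟩
  induction i using Fin.lastCases with
  | last => simp [h]
  | cast i => simp [hf]

theorem flagVertex_permSnoc (τ : Equiv.Perm (Fin n)) (s : Fin n → Bool) (i : Fin n) :
    flagVertex (permSnoc τ) (Fin.snoc s true) i.castSucc =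
      Fin.snoc (α := fun _ => SignType) (flagVertex τ s i) 0 := by
  funext j
  induction j using Fin.lastCases with
  | last => simp [flagVertex]
  | cast j => simp [flagVertex]

theorem flagLabels_permSnoc (τ : Equiv.Perm (Fin n)) (s : Fin n → Bool) :
    flagLabels κ (permSnoc τ) (Fin.snoc s true) (univ.erase (Fin.last n)) =
      flagLabels (fun x => κ (Fin.snoc (α := fun _ => SignType) x 0)) τ s univ := by
  have : univ.erase (Fin.last n) = univ.map Fin.castSuccEmb := by
    ext i
    simp [Fin.exists_castSucc_eq]
  simp only [flagLabels, this, map_val, Multiset.map_map, Function.comp_def, Fin.coe_castSuccEmb,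
    flagVertex_permSnoc]

theorem sum_flags_erase_last_of_eq (b : Bool) :
    ∑ p : Equiv.Perm (Fin (n + 1)) × (Fin n → Bool) with p.1 (Fin.last n) = Fin.last n,
      multisetAltInd b (flagLabels κ p.1 (Fin.snoc p.2 true) (univ.erase (Fin.last n))) =
    ∑ p : Equiv.Perm (Fin n) × (Fin n → Bool), multisetAltInd b
      (flagLabels (fun x => κ (Fin.snoc (α := fun _ => SignType) x 0)) p.1 p.2 univ) := by
  symm
  refine sum_bij (fun p _ => (permSnoc p.1, p.2)) ?_ ?_ ?_ ?_
  · simp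
  · rintro ⟨τ, s⟩ - ⟨τ', s'⟩ - h
    rw [Prod.mk.injEq] at h
    exact Prod.ext (permSnoc_injective h.1) h.2
  · rintro ⟨ρ, s⟩ hp
    obtain ⟨τ, rfl⟩ := exists_permSnoc_eq (mem_filter.1 hp).2
    exact ⟨(τ, s), mem_univ _, rfl⟩
  · rintro ⟨τ, s⟩ -
    rw [flagLabels_permSnoc]

variable {κ}

theorem sum_flags_succ
    (hanti : ∀ x : Fin (n + 1) → SignType, x ≠ 0 → κ (-x) = flipSign (κ x))
    (hκ : ∀ x y : Fin (n + 1) → SignType, x ≠ 0 → y ≠ 0 → (∀ i, x i = 0 ∨ x i = y i) →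
      κ x ≠ flipSign (κ y)) :
    ∑ p : Equiv.Perm (Fin (n + 1)) × (Fin (n + 1) → Bool),
      multisetAltInd true (flagLabels κ p.1 p.2 univ) =
    ∑ p : Equiv.Perm (Fin n) × (Fin n → Bool), multisetAltInd true
      (flagLabels (fun x => κ (Fin.snoc (α := fun _ => SignType) x 0)) p.1 p.2 univ) := by
  have hsplit : ∀ ρ : Equiv.Perm (Fin (n + 1)),
      ∑ s : Fin (n + 1) → Bool, multisetAltInd true (flagLabels κ ρ s univ) =
      ∑ s : Fin n → Bool, ∑ i,
        multisetAltInd true (flagLabels κ ρ (Fin.snoc s true) (univ.erase i)) := by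
    intro ρ
    rw [← (Fin.snocEquiv fun _ => Bool).sum_comp, Fintype.sum_prod_type, Fintype.sum_bool]
    simp only [sum_multisetAltInd_flagLabels_erase, sum_add_distrib]
    congr 1
    refine Fintype.sum_equiv (Equiv.piCongrRight fun _ => Equiv.boolNot) _ _ fun s => ?_
    rw [← multisetAltInd_flagLabels_not _ _ _ hanti hκ]
    congr 2
    funext j
    induction j using Fin.lastCases <;> simp
  rw [Fintype.sum_prod_type, sum_congr rfl fun ρ _ => hsplit ρ, ← Fintype.sum_prod_type', sum_comm,
    Fin.sum_univ_castSucc, sum_eq_zero fun k _ => sum_flags_erase_castSucc κ true k, zero_add,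
    ← sum_flags_erase_last_of_eq, ← sum_filter_add_sum_filter_not univ
      (fun p : Equiv.Perm (Fin (n + 1)) × (Fin n → Bool) => p.1 (Fin.last n) = Fin.last n),
    sum_flags_erase_last_of_ne, add_zero]

end Step

theorem sum_flags_eq_one {n : ℕ} (κ : (Fin n → SignType) → ℕ)
    (hanti : ∀ x : Fin n → SignType, x ≠ 0 → κ (-x) = flipSign (κ x))
    (hκ : ∀ x y : Fin n → SignType, x ≠ 0 → y ≠ 0 → (∀ i, x i = 0 ∨ x i = y i) →
      κ x ≠ flipSign (κ y)) :
    ∑ p : Equiv.Perm (Fin n) × (Fin n → Bool),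
      multisetAltInd true (flagLabels κ p.1 p.2 univ) = 1 := by
  induction n with
  | zero => simp [flagLabels, multisetAltInd, altInd]
  | succ n ih =>
    have hne : ∀ x : Fin n → SignType, x ≠ 0 → Fin.snoc (α := fun _ => SignType) x 0 ≠ 0 := by
      intro x hx h
      exact hx (funext fun i => by simpa using congrFun h i.castSucc)
    rw [sum_flags_succ hanti hκ]
    refine ih _ (fun x hx => ?_) fun x y hx hy hxy => hκ _ _ (hne x hx) (hne y hy) fun i => ?_
    · rw [← hanti _ (hne x hx)]
      congr 1
      funext i
      induction i using Fin.lastCases <;> simp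
    · induction i using Fin.lastCases with
      | last => simp
      | cast i => simpa using hxy i

end OctahedralTucker

open OctahedralTucker Finset in
/-- The Octahedral Tucker lemma. Sign vectors are functions `Fin n → SignType`;
`x ⪯ y` means that every nonzero coordinate of `x` agrees with `y`. -/
theorem octahedral_tucker (n : ℕ) (hn : 2 ≤ n)
    (lam : (Fin n → SignType) → ℤ)
    (hrange : ∀ x : Fin n → SignType, x ≠ 0 → lam x ≠ 0 ∧ |lam x| ≤ (n : ℤ) - 1)
    (hanti : ∀ x : Fin n → SignType, x ≠ 0 → lam (-x) = -lam x) :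
    ∃ x y : Fin n → SignType, x ≠ 0 ∧ y ≠ 0 ∧
      (∀ i, x i = 0 ∨ x i = y i) ∧ lam x = -lam y := by
  by_contra! hcon
  let κ : (Fin n → SignType) → ℕ := fun x => 2 * (lam x).natAbs + if 0 < lam x then 1 else 0
  have hκanti : ∀ x : Fin n → SignType, x ≠ 0 → κ (-x) = flipSign (κ x) := by
    intro x hx
    have := (hrange x hx).1
    simp only [κ, hanti x hx, flipSign]
    split_ifs <;> omega
  have hκ : ∀ x y : Fin n → SignType, x ≠ 0 → y ≠ 0 → (∀ i, x i = 0 ∨ x i = y i) →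
      κ x ≠ flipSign (κ y) := by
    intro x y hx hy hxy
    have h₁ := (hrange x hx).1
    have h₂ := (hrange y hy).1
    have h₃ := hcon x y hx hy hxy
    simp only [κ, flipSign]
    split_ifs <;> omega
  obtain ⟨⟨ρ, s⟩, -, hp⟩ := exists_ne_zero_of_sum_ne_zero
    (sum_flags_eq_one κ hκanti hκ ▸ one_ne_zero)
  have hlt := pairwise_half_lt_of_altInd_ne_zero (Multiset.pairwise_sort _ _)
    (by simpa only [Multiset.mem_sort] using flagLabels_ne_flipSign ρ s hκ) hp
  set L := ((flagLabels κ ρ s univ).sort (· ≤ ·)).map (· / 2) with hL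
  have hsub : L.toFinset ⊆ Icc 1 (n - 1) := by
    intro a ha
    simp only [hL, List.mem_toFinset, List.mem_map, Multiset.mem_sort, flagLabels,
      Multiset.mem_map] at ha
    obtain ⟨_, ⟨i, -, rfl⟩, rfl⟩ := ha
    have h := hrange _ (flagVertex_ne_zero ρ s i)
    rw [Int.abs_eq_natAbs] at h
    rw [mem_Icc]
    simp only [κ]
    split_ifs <;> omega
  have hcard := card_le_card hsub
  rw [List.toFinset_card_of_nodup (hlt.imp ne_of_lt)] at hcard
  simp [hL, flagLabels] at hcard
  omega
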